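/- arXiv:2408.14256 — 5 statements merged into one kernel-verified Lean document; each statement's English description precedes it below -/
import Mathlib

section
/- (Saturation lemma) Let A be an n×n matrix over the max-plus semiring such that A^k → O as k → ∞, let b be a column n-vector over ℝ_max, and set A* := I_n ⊕ A ⊕ A^2 ⊕ ⋯ ⊕ A^{n−1}. Then: (i) every vector x over ℝ_max with x ≤ A ⊗ x ⊕ b satisfies x ≤ A* ⊗ b; and (ii) the vector A* ⊗ b satisfies A ⊗ (A* ⊗ b) ⊕ b = A* ⊗ b. Hence A* ⊗ b is the greatest solution of the inequality x ≤ A ⊗ x ⊕ b, and it solves the equation x = A ⊗ x ⊕ b. -/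
open Finset

noncomputable section

/-- The max-plus identity matrix `I_n`: diagonal entries `𝟙 = 0`, off-diagonal `𝟘 = −∞`. -/
def mpId (n : ℕ) : Fin n → Fin n → WithBot ℝ :=
  fun i j => if i = j then (0 : WithBot ℝ) else ⊥

/-- Max-plus matrix product: `(A ⊗ B) i j = max_k (A i k + B k j)`. -/
def mpMul {n : ℕ} (A B : Fin n → Fin n → WithBot ℝ) : Fin n → Fin n → WithBot ℝ :=
  fun i j => Finset.univ.sup fun k => A i k + B k j

/-- Max-plus matrix power, `A^0 = I_n`. -/
def mpPow {n : ℕ} (A : Fin n → Fin n → WithBot ℝ) : ℕ → Fin n → Fin n → WithBot ℝ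
  | 0 => mpId n
  | k + 1 => mpMul A (mpPow A k)

/-- Max-plus matrix-vector product: `(A ⊗ x) i = max_k (A i k + x k)`. -/
def mpMulVec {n : ℕ} (A : Fin n → Fin n → WithBot ℝ) (x : Fin n → WithBot ℝ) :
    Fin n → WithBot ℝ :=
  fun i => Finset.univ.sup fun k => A i k + x k

/-- `A^k → O` as `k → ∞`: every entry of the max-plus powers `A^k` tends to `−∞`,
i.e. for each entry and every real bound `M` the entry of `A^k` is `≤ M` eventually. -/
def mpTendsToO {n : ℕ} (A : Fin n → Fin n → WithBot ℝ) : Prop :=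
  ∀ i j : Fin n, ∀ M : ℝ, ∃ K : ℕ, ∀ k : ℕ, K ≤ k → mpPow A k i j ≤ (M : WithBot ℝ)

theorem mp_attain {n : ℕ} (i : Fin n) (f : Fin n → WithBot ℝ) :
    ∃ k, Finset.univ.sup f = f k := by
  obtain ⟨k, -, hk⟩ := Finset.exists_mem_eq_sup Finset.univ ⟨i, Finset.mem_univ i⟩ f
  exact ⟨k, hk⟩

theorem mp_step {n : ℕ} (A B : Fin n → Fin n → WithBot ℝ) (i k j : Fin n) :
    A i k + B k j ≤ mpMul A B i j :=
  Finset.le_sup (f := fun k => A i k + B k j) (Finset.mem_univ k)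

theorem mp_stepVec {n : ℕ} (A : Fin n → Fin n → WithBot ℝ) (x : Fin n → WithBot ℝ)
    (i k : Fin n) : A i k + x k ≤ mpMulVec A x i :=
  Finset.le_sup (f := fun k => A i k + x k) (Finset.mem_univ k)

theorem mp_pow_add {n : ℕ} (A : Fin n → Fin n → WithBot ℝ) (s t : ℕ) :
    ∀ i k j, mpPow A s i k + mpPow A t k j ≤ mpPow A (s + t) i j := by
  induction s with
  | zero =>
    intro i k j
    by_cases h : i = k
    · subst h; simp [mpPow, mpId]
    · simp [mpPow, mpId, h]
  | succ s ih =>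
    intro i k j
    obtain ⟨l, hl⟩ := mp_attain i (fun l => A i l + mpPow A s l k)
    have e : mpPow A (s + 1) i k = A i l + mpPow A s l k := hl
    rw [e, Nat.add_right_comm s 1 t, add_assoc]
    exact (add_le_add_right (ih l k j) _).trans (mp_step A (mpPow A (s + t)) i l j)

theorem mp_path_le {n : ℕ} (A : Fin n → Fin n → WithBot ℝ) (m : ℕ) :
    ∀ p : ℕ → Fin n, ∑ t ∈ Finset.range m, A (p t) (p (t + 1)) ≤ mpPow A m (p 0) (p m) := by
  induction m with
  | zero => intro p; simp [mpPow, mpId]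
  | succ m ih =>
    intro p
    rw [Finset.sum_range_succ', add_comm]
    exact (add_le_add_right (ih fun t => p (t + 1)) _).trans
      (mp_step A (mpPow A m) (p 0) (p 1) (p (m + 1)))

theorem mp_exists_path {n : ℕ} (A : Fin n → Fin n → WithBot ℝ) (m : ℕ) :
    ∀ i j, mpPow A m i j = ⊥ ∨ ∃ p : ℕ → Fin n, p 0 = i ∧ p m = j ∧
      mpPow A m i j = ∑ t ∈ Finset.range m, A (p t) (p (t + 1)) := by
  induction m with
  | zero =>
    intro i j
    by_cases h : i = j
    · right; exact ⟨fun _ => i, rfl, h, by simp [mpPow, mpId, h]⟩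
    · left; simp [mpPow, mpId, h]
  | succ m ih =>
    intro i j
    obtain ⟨l, hl⟩ := mp_attain i (fun l => A i l + mpPow A m l j)
    have e : mpPow A (m + 1) i j = A i l + mpPow A m l j := hl
    rcases ih l j with h | ⟨p, h0, hm, hp⟩
    · left; rw [e, h]; simp
    · right
      refine ⟨fun t => Nat.casesOn t i p, rfl, hm, ?_⟩
      rw [e, hp, Finset.sum_range_succ', add_comm]
      simp [h0]

theorem mp_diag {n : ℕ} (A : Fin n → Fin n → WithBot ℝ) (hA : mpTendsToO A) (m : ℕ)
    (hm : 0 < m) (i : Fin n) : mpPow A m i i ≤ 0 := by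
  by_contra hc
  rw [not_le] at hc
  have key : ∀ k : ℕ, mpPow A m i i ≤ mpPow A (k * m + m) i i := by
    intro k
    induction k with
    | zero => simp
    | succ k ih =>
      have := mp_pow_add A (k * m + m) m i i i
      rw [Nat.succ_mul]
      refine le_trans ?_ this
      exact le_add_of_nonneg_left (hc.le.trans ih)
  obtain ⟨K, hK⟩ := hA i i 0
  have h1 := hK (K * m + m) (by nlinarith)
  exact absurd ((key K).trans h1) (not_le.mpr hc)

theorem mp_star {n : ℕ} (A : Fin n → Fin n → WithBot ℝ) (hA : mpTendsToO A) (m : ℕ) :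
    ∀ i j, mpPow A m i j ≤ (Finset.range n).sup fun t => mpPow A t i j := by
  induction m using Nat.strong_induction_on with
  | _ m ih =>
    intro i j
    by_cases hmn : m < n
    · exact Finset.le_sup (f := fun t => mpPow A t i j) (Finset.mem_range.mpr hmn)
    rcases mp_exists_path A m i j with h | ⟨p, h0, hm, hp⟩
    · rw [h]; exact bot_le
    obtain ⟨s, t, hst, htn, hpst⟩ : ∃ s t : ℕ, s < t ∧ t ≤ n ∧ p s = p t := by
      obtain ⟨a, b, hab, he⟩ := Fintype.exists_ne_map_eq_of_card_lt
        (fun t : Fin (n + 1) => p t) (by simp)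
      rcases lt_or_gt_of_ne hab with h | h
      · exact ⟨a, b, h, by omega, he⟩
      · exact ⟨b, a, h, by omega, he.symm⟩
    obtain ⟨d, rfl⟩ := Nat.exists_eq_add_of_lt hst
    obtain ⟨e, rfl⟩ := Nat.exists_eq_add_of_le (show s + d + 1 ≤ m by omega)
    have w1 := mp_path_le A s p
    have w2 := mp_path_le A (d + 1) (fun u => p (s + u))
    have w3 := mp_path_le A e (fun u => p (s + (d + 1) + u))
    have hd : mpPow A (d + 1) (p s) (p (s + (d + 1))) ≤ 0 := by
      have : p (s + (d + 1)) = p s := hpst.symm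
      rw [this]
      exact mp_diag A hA _ (Nat.succ_pos d) _
    have w2' := w2.trans hd
    have hsum : mpPow A (s + d + 1 + e) i j ≤ mpPow A s (p s |> fun _ => i) (p s) + 0
        + mpPow A e (p s) j := by
      rw [hp, Nat.add_assoc s d 1, Finset.sum_range_add, Finset.sum_range_add]
      refine add_le_add (add_le_add ?_ w2') ?_
      · rw [← h0]; exact w1
      · rw [← hm, hpst]; exact w3
    rw [add_zero] at hsum
    exact hsum.trans ((mp_pow_add A s e i (p s) j).trans (ih (s + e) (by omega) i j))

/-- Saturation lemma: if `A^k → O`, then with `A* = I ⊕ A ⊕ ⋯ ⊕ A^{n−1}`,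
(i) every `x` with `x ≤ A ⊗ x ⊕ b` satisfies `x ≤ A* ⊗ b`, and
(ii) `A ⊗ (A* ⊗ b) ⊕ b = A* ⊗ b`; so `A* ⊗ b` is the greatest solution of
`x ≤ A ⊗ x ⊕ b` and solves `x = A ⊗ x ⊕ b`. -/
theorem mp_saturation {n : ℕ} (A : Fin n → Fin n → WithBot ℝ) (b : Fin n → WithBot ℝ)
    (hA : mpTendsToO A)
    (Astar : Fin n → Fin n → WithBot ℝ)
    (hAstar : Astar = fun i j => (Finset.range n).sup fun t => mpPow A t i j) :
    (∀ x : Fin n → WithBot ℝ,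
        (x ≤ fun i => mpMulVec A x i ⊔ b i) → x ≤ mpMulVec Astar b) ∧
      (fun i => mpMulVec A (mpMulVec Astar b) i ⊔ b i) = mpMulVec Astar b := by
  have hle : ∀ m i j, mpPow A m i j ≤ Astar i j := by
    intro m i j; rw [hAstar]; exact mp_star A hA m i j
  have hatt : ∀ i j, ∃ t, Astar i j = mpPow A t i j := by
    intro i j
    obtain ⟨t, -, ht⟩ := Finset.exists_mem_eq_sup (Finset.range n)
      ⟨0, Finset.mem_range.mpr i.pos⟩ (fun t => mpPow A t i j)
    exact ⟨t, by rw [hAstar]; exact ht⟩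
  have hii : (fun i => mpMulVec A (mpMulVec Astar b) i ⊔ b i) = mpMulVec Astar b := by
    funext i
    apply le_antisymm
    · refine sup_le (Finset.sup_le fun k _ => ?_) ?_
      · obtain ⟨j, hj⟩ := mp_attain k (fun j => Astar k j + b j)
        have e : mpMulVec Astar b k = Astar k j + b j := hj
        obtain ⟨t, ht⟩ := hatt k j
        rw [e, ht, ← add_assoc]
        exact (add_le_add_left ((mp_step A (mpPow A t) i k j).trans (hle (t + 1) i j)) _).trans
          (mp_stepVec Astar b i j)
      · have h := (add_le_add_left (hle 0 i i) (b i)).trans (mp_stepVec Astar b i i)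
        simpa [mpPow, mpId] using h
    · refine Finset.sup_le fun j _ => ?_
      obtain ⟨t, ht⟩ := hatt i j
      rw [ht]
      cases t with
      | zero =>
        by_cases h : i = j
        · subst h; simp [mpPow, mpId]
        · simp [mpPow, mpId, h]
      | succ t =>
        obtain ⟨l, hl⟩ := mp_attain i (fun l => A i l + mpPow A t l j)
        have e : mpPow A (t + 1) i j = A i l + mpPow A t l j := hl
        rw [e, add_assoc]
        refine le_sup_of_le_left (le_trans ?_ (mp_stepVec A (mpMulVec Astar b) i l))
        exact add_le_add_right
          ((add_le_add_left (hle t l j) _).trans (mp_stepVec Astar b l j)) _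
  refine ⟨?_, hii⟩
  intro x hx
  have key : ∀ k i, x i ≤ mpMulVec Astar b i ∨ ∃ l, x i ≤ mpPow A k i l + x l := by
    intro k
    induction k with
    | zero => intro i; right; exact ⟨i, by simp [mpPow, mpId]⟩
    | succ k ih =>
      intro i
      have hy : mpMulVec A (mpMulVec Astar b) i ⊔ b i = mpMulVec Astar b i := congrFun hii i
      rcases le_sup_iff.mp (hx i) with h | h
      · obtain ⟨l, hl⟩ := mp_attain i (fun l => A i l + x l)
        have e : mpMulVec A x i = A i l + x l := hl
        rw [e] at h
        rcases ih l with h' | ⟨q, hq⟩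
        · left
          rw [← hy]
          exact le_sup_of_le_left ((h.trans (add_le_add_right h' _)).trans (mp_stepVec A _ i l))
        · right
          refine ⟨q, (h.trans (add_le_add_right hq _)).trans ?_⟩
          rw [← add_assoc]
          exact add_le_add_left (mp_step A (mpPow A k) i l q) _
      · left; rw [← hy]; exact le_sup_of_le_right h
  intro i
  by_contra hc
  have hr : x i ≠ ⊥ := by
    intro h; rw [h] at hc; exact hc bot_le
  obtain ⟨r, hr⟩ := WithBot.ne_bot_iff_exists.mp hr
  have hK : ∀ l, ∃ K : ℕ, ∀ k, K ≤ k → ¬ x i ≤ mpPow A k i l + x l := by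
    intro l
    rcases eq_or_ne (x l) ⊥ with h | h
    · refine ⟨0, fun k _ => ?_⟩
      rw [h, ← hr]; simp
    · obtain ⟨q, hq⟩ := WithBot.ne_bot_iff_exists.mp h
      obtain ⟨K, hK⟩ := hA i l (r - q - 1)
      refine ⟨K, fun k hk hle => ?_⟩
      have h2 := hle.trans (add_le_add_left (hK k hk) _)
      rw [← hr, ← hq, ← WithBot.coe_add, WithBot.coe_le_coe] at h2
      linarith
  choose K hK using hK
  rcases key (Finset.univ.sup K) i with h | ⟨l, hl⟩
  · exact hc h
  · exact hK l _ (Finset.le_sup (Finset.mem_univ l)) hl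

end
end

section
/- Let A be an n×n matrix over the max-plus semiring that is irreducible, i.e., its associated digraph G(A) is strongly connected. If every circuit of G(A) has weight < 0, then A^k → O as k → ∞, i.e., every entry of A^k tends to −∞. -/
open Finset

noncomputable section

def pw {n : ℕ} (A : Fin n → Fin n → WithBot ℝ) (p : ℕ → Fin n) (k : ℕ) : WithBot ℝ :=
  ∑ t ∈ Finset.range k, A (p (t + 1)) (p t)

theorem pw_le {n : ℕ} (A : Fin n → Fin n → WithBot ℝ) (p : ℕ → Fin n) (k : ℕ) :
    pw A p k ≤ mpPow A k (p k) (p 0) := by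
  induction k with
  | zero => simp [pw, mpPow, mpId]
  | succ k ih =>
    have h1 : pw A p (k + 1) = A (p (k + 1)) (p k) + pw A p k := by
      rw [pw, Finset.sum_range_succ, add_comm]; rfl
    rw [h1]
    refine le_trans (add_le_add le_rfl ih) ?_
    exact Finset.le_sup (f := fun l => A (p (k + 1)) l + mpPow A k l (p 0)) (Finset.mem_univ (p k))

theorem pw_congr {n : ℕ} (A : Fin n → Fin n → WithBot ℝ) (p q : ℕ → Fin n) (k : ℕ)
    (h : ∀ t ≤ k, p t = q t) : pw A p k = pw A q k := by
  refine Finset.sum_congr rfl fun t ht => ?_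
  have := Finset.mem_range.1 ht
  rw [h t (by omega), h (t + 1) (by omega)]

theorem pw_add {n : ℕ} (A : Fin n → Fin n → WithBot ℝ) (p : ℕ → Fin n) (k l : ℕ) :
    pw A p (k + l) = pw A p k + pw A (fun t => p (k + t)) l := by
  simp only [pw, Finset.sum_range_add, add_assoc]

theorem exists_path {n : ℕ} (A : Fin n → Fin n → WithBot ℝ) (k : ℕ) (i j : Fin n)
    (h : mpPow A k i j ≠ ⊥) : ∃ p : ℕ → Fin n, p 0 = j ∧ p k = i ∧
      (∀ t < k, A (p (t + 1)) (p t) ≠ ⊥) ∧ pw A p k = mpPow A k i j := by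
  induction k generalizing i with
  | zero =>
    by_cases hij : i = j
    · subst hij
      exact ⟨fun _ => i, rfl, rfl, by simp, by simp [pw, mpPow, mpId]⟩
    · simp [mpPow, mpId, hij] at h
  | succ k ih =>
    obtain ⟨l, -, hl⟩ := Finset.exists_mem_eq_sup (Finset.univ : Finset (Fin n)) ⟨j, Finset.mem_univ j⟩
      (fun l => A i l + mpPow A k l j)
    have hl' : mpPow A (k + 1) i j = A i l + mpPow A k l j := hl
    rw [hl'] at h ⊢
    rw [Ne, WithBot.add_eq_bot, not_or] at h
    obtain ⟨p, h0, hk, hb, hw⟩ := ih l h.2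
    refine ⟨fun t => if t ≤ k then p t else i, by simpa using h0, by simp, ?_, ?_⟩
    · intro t ht
      rcases Nat.lt_or_ge t k with h' | h'
      · have e1 : t + 1 ≤ k := h'
        have e2 : t ≤ k := by omega
        simp only [e1, e2, if_true]
        exact hb t h'
      · have e : t = k := by omega
        subst e
        simpa [hk] using h.1
    · rw [pw_add, ← hw, add_comm]
      congr 1
      · simp [pw, hk]
      · exact pw_congr _ _ _ _ fun t ht => by simp [ht]

theorem pw_bound {n : ℕ} (A : Fin n → Fin n → WithBot ℝ) (B δ ε : ℝ) (hB0 : 0 ≤ B)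
    (hε : 0 < ε) (hεδ : n * ε ≤ δ)
    (hB : ∀ i j, A i j ≤ ((B - ε : ℝ) : WithBot ℝ))
    (hδ : ∀ k, 0 < k → k ≤ n → ∀ i, mpPow A k i i ≤ ((-δ : ℝ) : WithBot ℝ)) (k : ℕ) :
    ∀ p : ℕ → Fin n, pw A p k ≤ ((n * B - k * ε : ℝ) : WithBot ℝ) := by
  induction k using Nat.strong_induction_on with
  | _ k ih =>
    intro p
    rcases Nat.lt_or_ge n k with hk | hk
    · obtain ⟨a, b, hab, hp⟩ := Fintype.exists_ne_map_eq_of_card_lt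
        (fun t : Fin (n + 1) => p t) (by simp)
      obtain ⟨s, t, hst, htn, hpst⟩ : ∃ s t : ℕ, s < t ∧ t ≤ n ∧ p s = p t := by
        have h1 := a.2
        have h2 := b.2
        rcases lt_or_gt_of_ne (fun h => hab (Fin.ext h) : (a : ℕ) ≠ b) with h | h
        · exact ⟨a, b, h, by omega, hp⟩
        · exact ⟨b, a, h, by omega, hp.symm⟩
      obtain ⟨d, rfl⟩ := Nat.exists_eq_add_of_lt hst
      obtain ⟨r, rfl⟩ := Nat.exists_eq_add_of_le (show s + d + 1 ≤ k by omega)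
      set q : ℕ → Fin n := fun u => if u ≤ s then p u else p (u + (d + 1)) with hq
      have hqw : pw A q (s + r) = pw A p s + pw A (fun u => p (s + d + 1 + u)) r := by
        rw [pw_add]
        congr 1
        · exact pw_congr _ _ _ _ fun u hu => by simp [hq, hu]
        · refine pw_congr _ _ _ _ fun u _ => ?_
          rcases Nat.eq_zero_or_pos u with rfl | hu
          · simpa [hq] using hpst
          · have : ¬ s + u ≤ s := by omega
            simp only [hq, this, if_false]
            congr 1; omega
      have h1 := ih (s + r) (by omega) q
      have h2 : pw A (fun u => p (s + u)) (d + 1) ≤ ((-δ : ℝ) : WithBot ℝ) := by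
        refine le_trans (pw_le _ _ _) ?_
        have e : p (s + (d + 1)) = p (s + 0) := hpst.symm
        simp only [e]
        exact hδ _ (by omega) (by omega) _
      have h3 : pw A p (s + d + 1 + r) = pw A (fun u => p (s + u)) (d + 1) + pw A q (s + r) := by
        rw [hqw, pw_add, add_assoc s d 1, pw_add]
        abel
      rw [h3]
      refine le_trans (add_le_add h2 h1) ?_
      rw [← WithBot.coe_add, WithBot.coe_le_coe]
      push_cast
      have : ((d : ℝ) + 1) ≤ n := by exact_mod_cast (show d + 1 ≤ n by omega)
      nlinarith
    · have : ∀ k : ℕ, pw A p k ≤ ((k * (B - ε) : ℝ) : WithBot ℝ) := by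
        intro k
        induction k with
        | zero => simp [pw]
        | succ k ih =>
          rw [pw, Finset.sum_range_succ]
          refine le_trans (add_le_add ih (hB _ _)) ?_
          rw [← WithBot.coe_add, WithBot.coe_le_coe]
          push_cast
          linarith
      refine le_trans (this k) ?_
      rw [WithBot.coe_le_coe]
      have : (k : ℝ) ≤ n := by exact_mod_cast hk
      nlinarith

/-- If `A` is irreducible (its digraph `G(A)` is strongly connected: every vertex `i`
is reachable from every vertex `j` by a path whose arcs all have weight `≠ −∞`)
and every circuit of `G(A)` has weight `< 0`, then `A^k → O` as `k → ∞`. -/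
theorem mp_irreducible_negCircuits_tendsToO {n : ℕ} (A : Fin n → Fin n → WithBot ℝ)
    (hirr : ∀ i j : Fin n, ∃ (m : ℕ) (p : ℕ → Fin n), p 0 = j ∧ p m = i ∧
      ∀ t < m, A (p (t + 1)) (p t) ≠ ⊥)
    (hcirc : ∀ (m : ℕ) (p : ℕ → Fin n), p (m + 1) = p 0 →
      (∀ t ≤ m, A (p (t + 1)) (p t) ≠ ⊥) →
      (∑ t ∈ Finset.range (m + 1), A (p (t + 1)) (p t)) < (0 : WithBot ℝ)) :
    mpTendsToO A := by
  have hneg : ∀ x : Fin n × Fin n, ∃ δ : Set.Ioi (0 : ℝ),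
      mpPow A (x.1 + 1) x.2 x.2 ≤ ((-(δ : ℝ) : ℝ) : WithBot ℝ) := by
    rintro ⟨k, i⟩
    by_cases h : mpPow A (k + 1) i i = ⊥
    · exact ⟨⟨1, Set.mem_Ioi.2 one_pos⟩, by simp [h]⟩
    · obtain ⟨p, h0, hk, hb, hw⟩ := exists_path A _ i i h
      have h1 := hcirc k p (hk.trans h0.symm) (fun t ht => hb t (by omega))
      change pw A p (k + 1) < 0 at h1
      rw [hw] at h1
      obtain ⟨r, hr⟩ := WithBot.ne_bot_iff_exists.1 h
      rw [← hr] at h1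
      have hr0 : r < 0 := by exact_mod_cast h1
      exact ⟨⟨-r, by simpa using hr0⟩, by simp [← hr]⟩
  choose f hf using hneg
  obtain ⟨⟨δ, hδ0⟩, hδ⟩ := Finite.exists_ge f
  have hδ0 : 0 < δ := hδ0
  obtain ⟨B, hB⟩ := Finite.exists_le (fun x : Fin n × Fin n => (A x.1 x.2).unbotD 0)
  intro i j M
  have hn : 0 < (n : ℝ) := by exact_mod_cast i.pos
  have hε : 0 < δ / n := div_pos hδ0 hn
  have key := pw_bound A (max B 0 + δ / n) δ (δ / n) (by positivity) hε
    (by rw [mul_div_cancel₀ _ hn.ne']) (by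
      intro i j
      have := hB (i, j)
      rcases h : A i j with _ | a
      · exact bot_le
      · simp only [h] at this
        refine WithBot.coe_le_coe.2 ?_
        have h' : a ≤ B := this
        have := le_max_left B 0
        linarith) (by
      intro k hk hkn i
      refine le_trans (by simpa [Nat.sub_add_cancel hk] using hf (⟨k - 1, by omega⟩, i)) (b := ((-(f (⟨k - 1, by omega⟩, i) : ℝ) : ℝ) : WithBot ℝ)) ?_
      refine WithBot.coe_le_coe.2 (neg_le_neg ?_)
      exact hδ (⟨k - 1, by omega⟩, i))
  obtain ⟨K, hK⟩ := exists_nat_ge ((n * (max B 0 + δ / n) - M) / (δ / n))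
  refine ⟨K, fun k hk => ?_⟩
  by_cases h : mpPow A k i j = ⊥
  · simp [h]
  · obtain ⟨p, -, -, -, hw⟩ := exists_path A k i j h
    rw [← hw]
    refine le_trans (key k p) (WithBot.coe_le_coe.2 ?_)
    rw [div_le_iff₀ hε] at hK
    have : (K : ℝ) ≤ k := by exact_mod_cast hk
    nlinarith

end
end

section
/- Let A be an n×n monomial matrix over the max-plus semiring all of whose non-(−∞) entries are ≥ 0, let A⁻ be its monomial inverse ((A⁻)_{i,j} = −a_{j,i} if a_{j,i} ≠ −∞, and −∞ otherwise), and set (A⁻)* := I_n ⊕ A⁻ ⊕ (A⁻)^2 ⊕ ⋯ ⊕ (A⁻)^{n−1}. Then the solution set {x ∈ ℝ_max^n : x ≤ A ⊗ x} is exactly the set of max-plus linear combinations of the columns of (A⁻)*, i.e., {x : x ≤ A ⊗ x} = {(A⁻)* ⊗ y : y ∈ ℝ_max^n}. -/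
open Finset

noncomputable section

/-- A square max-plus matrix is monomial if every row and every column contains exactly
one entry different from `−∞` (equivalently `A = D ⊗ P` with `D` an invertible diagonal
matrix and `P` a permutation matrix). -/
def mpMonomial {n : ℕ} (A : Fin n → Fin n → WithBot ℝ) : Prop :=
  (∀ i : Fin n, ∃! j : Fin n, A i j ≠ ⊥) ∧ (∀ j : Fin n, ∃! i : Fin n, A i j ≠ ⊥)

/-- The candidate monomial inverse `A⁻`:
`(A⁻)_{i,j} = −a_{j,i}` if `a_{j,i} ≠ −∞`, and `(A⁻)_{i,j} = −∞` otherwise. -/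
def mpInv {n : ℕ} (A : Fin n → Fin n → WithBot ℝ) : Fin n → Fin n → WithBot ℝ :=
  fun i j => WithBot.recBotCoe (⊥ : WithBot ℝ) (fun r : ℝ => ((-r : ℝ) : WithBot ℝ)) (A j i)

theorem aux_pow {n : ℕ} (B : Fin n → Fin n → WithBot ℝ) (σ : Fin n → Fin n) (a : Fin n → ℝ)
    (hB : ∀ k i, B k i = if k = σ i then ((-a i : ℝ) : WithBot ℝ) else ⊥) (t : ℕ) (k j : Fin n) :
    mpPow B t k j = if k = σ^[t] j then
      ((-∑ s ∈ Finset.range t, a (σ^[s] j) : ℝ) : WithBot ℝ) else ⊥ := by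
  induction t generalizing k with
  | zero => simp [mpPow, mpId]
  | succ t ih =>
    simp only [mpPow, mpMul]
    simp only [ih, hB]
    apply le_antisymm
    · apply Finset.sup_le
      intro i _
      by_cases hi : i = σ^[t] j
      · subst hi
        rw [Function.iterate_succ_apply']
        by_cases hk : k = σ (σ^[t] j)
        · simp only [hk, if_true]
          rw [← WithBot.coe_add, WithBot.coe_le_coe, Finset.sum_range_succ]
          linarith
        · simp [hk]
      · simp [hi]
    · refine le_trans ?_ (Finset.le_sup (Finset.mem_univ (σ^[t] j)))
      rw [Function.iterate_succ_apply']
      by_cases hk : k = σ (σ^[t] j)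
      · simp only [hk, if_true]
        rw [← WithBot.coe_add, WithBot.coe_le_coe, Finset.sum_range_succ]
        linarith
      · simp [hk]

theorem aux_main {n : ℕ} (B : Fin n → Fin n → WithBot ℝ) (σ : Fin n → Fin n) (a : Fin n → ℝ)
    (ha : ∀ i, 0 ≤ a i)
    (hB : ∀ k i, B k i = if k = σ i then ((-a i : ℝ) : WithBot ℝ) else ⊥) (t : ℕ) (ht : t ≤ n)
    (k j : Fin n) :
    mpPow B t k j ≤ (Finset.range n).sup fun t => mpPow B t k j := by
  rcases ht.lt_or_eq with h | rfl
  · exact Finset.le_sup (f := fun t => mpPow B t k j) (Finset.mem_range.2 h)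
  · obtain ⟨p, q, hpq, he⟩ : ∃ p q : Fin (t+1), p < q ∧ σ^[p] j = σ^[q] j := by
      obtain ⟨p, q, hne, he⟩ := Fintype.exists_ne_map_eq_of_card_lt
        (fun s : Fin (t+1) => σ^[s] j) (by simp)
      rcases lt_or_gt_of_ne hne with h | h
      · exact ⟨p, q, h, he⟩
      · exact ⟨q, p, h, he.symm⟩
    have hq : (q : ℕ) ≤ t := by omega
    have hpq' : (p : ℕ) < q := hpq
    have hit : σ^[t - q + p] j = σ^[t] j := by
      rw [Function.iterate_add_apply, he, ← Function.iterate_add_apply, Nat.sub_add_cancel hq]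
    refine le_trans ?_ (Finset.le_sup (f := fun t => mpPow B t k j)
      (Finset.mem_range.2 (show t - q + p < t by omega)))
    simp only [aux_pow B σ a hB, hit]
    split_ifs
    · rw [WithBot.coe_le_coe, neg_le_neg_iff]
      apply Finset.sum_le_sum_of_subset_of_nonneg
      · intro s hs
        simp only [Finset.mem_range] at *
        omega
      · intro s _ _
        exact ha _
    · exact le_rfl

theorem aux_pow_le {n : ℕ} (B : Fin n → Fin n → WithBot ℝ) (x : Fin n → WithBot ℝ)
    (h : ∀ k i, B k i + x i ≤ x k) (t : ℕ) (k j : Fin n) : mpPow B t k j + x j ≤ x k := by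
  induction t generalizing k with
  | zero =>
    simp only [mpPow, mpId]
    split_ifs with e
    · simp [e]
    · simp
  | succ t ih =>
    simp only [mpPow, mpMul]
    haveI : Nonempty (Fin n) := ⟨k⟩
    obtain ⟨i, _, hi⟩ := Finset.exists_mem_eq_sup Finset.univ Finset.univ_nonempty
      (fun i => B k i + mpPow B t i j)
    rw [hi, add_assoc]
    exact (add_le_add le_rfl (ih i)).trans (h k i)

/-- For a monomial max-plus matrix `A` all of whose non-`−∞` entries are `≥ 0`, with
monomial inverse `A⁻` and `(A⁻)* = I ⊕ A⁻ ⊕ ⋯ ⊕ (A⁻)^{n−1}`, the solution set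
`{x : x ≤ A ⊗ x}` is exactly the set of max-plus linear combinations of the columns
of `(A⁻)*`, i.e. `{(A⁻)* ⊗ y : y ∈ ℝ_max^n}`. -/
theorem mp_monomial_cone_description {n : ℕ} (A : Fin n → Fin n → WithBot ℝ)
    (hA : mpMonomial A)
    (hpos : ∀ i j, A i j ≠ ⊥ → (0 : WithBot ℝ) ≤ A i j)
    (AinvStar : Fin n → Fin n → WithBot ℝ)
    (hAinvStar : AinvStar = fun i j => (Finset.range n).sup fun t => mpPow (mpInv A) t i j)
    (x : Fin n → WithBot ℝ) :
    x ≤ mpMulVec A x ↔ ∃ y : Fin n → WithBot ℝ, x = mpMulVec AinvStar y := by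
  have hne : ∀ i : Fin n, (Finset.range n).Nonempty := fun i => ⟨i, by simp⟩
  obtain ⟨σ, a, ha, hσ⟩ : ∃ (σ : Fin n → Fin n) (a : Fin n → ℝ), (∀ i, 0 ≤ a i) ∧
      ∀ i j, A i j = if j = σ i then (a i : WithBot ℝ) else ⊥ := by
    choose σ h1 h2 using hA.1
    simp only at h1 h2
    choose a ha using fun i => WithBot.ne_bot_iff_exists.1 (h1 i)
    refine ⟨σ, a, fun i => ?_, fun i j => ?_⟩
    · have := hpos i (σ i) (h1 i)
      rw [← ha i] at this
      exact_mod_cast this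
    · split_ifs with e
      · rw [e, ha]
      · by_contra h
        exact e (h2 i j h)
  have hB : ∀ k i, mpInv A k i = if k = σ i then ((-a i : ℝ) : WithBot ℝ) else ⊥ := by
    intro k i
    simp only [mpInv, hσ]
    split_ifs <;> rfl
  have key : x ≤ mpMulVec A x ↔ ∀ k i, mpInv A k i + x i ≤ x k := by
    have h1 : ∀ i, mpMulVec A x i = (a i : WithBot ℝ) + x (σ i) := by
      intro i
      simp only [mpMulVec]
      apply le_antisymm
      · apply Finset.sup_le
        intro k _
        rw [hσ]
        split_ifs with e
        · rw [e]
        · simp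
      · refine le_trans ?_ (Finset.le_sup (Finset.mem_univ (σ i)))
        simp [hσ]
    have h2 : ∀ i, x i ≤ (a i : WithBot ℝ) + x (σ i) ↔
        ((-a i : ℝ) : WithBot ℝ) + x i ≤ x (σ i) := by
      intro i
      induction x i using WithBot.recBotCoe with
      | bot => simp
      | coe u =>
        induction x (σ i) using WithBot.recBotCoe with
        | bot => simp [← WithBot.coe_add]
        | coe v =>
          simp only [← WithBot.coe_add, WithBot.coe_le_coe]
          constructor <;> intro h <;> linarith
    rw [Pi.le_def]
    simp only [h1, h2, hB]
    constructor
    · intro h k i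
      split_ifs with e
      · rw [e]
        exact h i
      · simp
    · intro h i
      simpa using h (σ i) i
  rw [key]
  subst hAinvStar
  constructor
  · intro h
    refine ⟨x, funext fun i => le_antisymm ?_ ?_⟩
    · refine le_trans ?_ (Finset.le_sup (Finset.mem_univ i))
      have h0 : (0 : WithBot ℝ) ≤ (Finset.range n).sup fun t => mpPow (mpInv A) t i i := by
        refine le_trans ?_ (Finset.le_sup (Finset.mem_range.2 i.pos))
        simp [mpPow, mpId]
      simpa using add_le_add h0 (le_refl (x i))
    · apply Finset.sup_le
      intro j _
      obtain ⟨t, _, ht⟩ := Finset.exists_mem_eq_sup _ (hne i)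
        (fun t => mpPow (mpInv A) t i j)
      simp only [ht]
      exact aux_pow_le _ x h t i j
  · rintro ⟨y, rfl⟩ k i
    haveI : Nonempty (Fin n) := ⟨k⟩
    simp only [mpMulVec]
    obtain ⟨j, _, hj⟩ := Finset.exists_mem_eq_sup Finset.univ Finset.univ_nonempty
      (fun j => ((Finset.range n).sup fun t => mpPow (mpInv A) t i j) + y j)
    rw [hj]
    refine le_trans ?_ (Finset.le_sup (Finset.mem_univ j))
    obtain ⟨t, htn, ht⟩ := Finset.exists_mem_eq_sup _ (hne i)
        (fun t => mpPow (mpInv A) t i j)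
    simp only [ht]
    rw [← add_assoc]
    refine add_le_add ?_ le_rfl
    refine le_trans ?_ (aux_main (mpInv A) σ a ha hB (t+1) (Finset.mem_range.1 htn) k j)
    exact Finset.le_sup (f := fun i => mpInv A k i + mpPow (mpInv A) t i j) (Finset.mem_univ i)

end
end

section
/- Let M be an n×n matrix over the max-plus semiring all of whose entries are ≤ 0, and set M* := I_n ⊕ M ⊕ M^2 ⊕ ⋯ ⊕ M^{n−1}. Then the set of vectors x ∈ ℝ_max^n satisfying M ⊗ x ≤ x is exactly {M* ⊗ y : y ∈ ℝ_max^n}; moreover x satisfies M ⊗ x ≤ x if and only if x = M* ⊗ x. -/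
open Finset

noncomputable section

theorem mpx_walk_le {n : ℕ} (M : Fin n → Fin n → WithBot ℝ) (p : ℕ → Fin n) (m : ℕ) :
    ∀ a, ∑ t ∈ Finset.range m, M (p (a + t)) (p (a + t + 1)) ≤ mpPow M m (p a) (p (a + m)) := by
  induction m with
  | zero => intro a; simp [mpPow, mpId]
  | succ m ih =>
    intro a
    rw [Finset.sum_range_succ', add_comm]
    have h := ih (a + 1)
    have e : ∀ t, a + 1 + t = a + (t + 1) := fun t => by omega
    simp only [e] at h
    refine le_trans (add_le_add le_rfl h) ?_
    exact Finset.le_sup (f := fun k => M (p a) k + mpPow M m k (p (a + (m + 1))))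
      (Finset.mem_univ (p (a + 1)))

theorem mpx_exists_walk {n : ℕ} (M : Fin n → Fin n → WithBot ℝ) (m : ℕ) :
    ∀ i j, mpPow M m i j = ⊥ ∨ ∃ p : ℕ → Fin n, p 0 = i ∧ p m = j ∧
      mpPow M m i j = ∑ t ∈ Finset.range m, M (p t) (p (t + 1)) := by
  induction m with
  | zero =>
    intro i j
    by_cases h : i = j
    · right; exact ⟨fun _ => i, rfl, h, by simp [mpPow, mpId, h]⟩
    · left; simp [mpPow, mpId, h]
  | succ m ih =>
    intro i j
    obtain ⟨l, -, hl⟩ := Finset.exists_mem_eq_sup (Finset.univ : Finset (Fin n)) ⟨i, Finset.mem_univ i⟩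
      (fun k => M i k + mpPow M m k j)
    have hl' : mpPow M (m + 1) i j = M i l + mpPow M m l j := hl
    rcases ih l j with h | ⟨p, h0, hm, hp⟩
    · left; rw [hl', h, WithBot.add_bot]
    · right
      refine ⟨fun t => Nat.casesOn t i p, rfl, hm, ?_⟩
      rw [hl', Finset.sum_range_succ', add_comm, hp]
      simp [h0]

theorem mpx_add_sup {n : ℕ} {s : Finset ℕ} (hs : s.Nonempty) (c d : WithBot ℝ) (f : ℕ → WithBot ℝ)
    (h : ∀ t ∈ s, c + f t ≤ d) : c + s.sup f ≤ d := by
  obtain ⟨t, ht, e⟩ := Finset.exists_mem_eq_sup s hs f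
  rw [e]; exact h t ht

theorem mpx_pow_add {n : ℕ} (M : Fin n → Fin n → WithBot ℝ) (a b : ℕ) :
    ∀ i l j, mpPow M a i l + mpPow M b l j ≤ mpPow M (a + b) i j := by
  induction a with
  | zero =>
    intro i l j
    by_cases h : i = l
    · simp [mpPow, mpId, h]
    · simp [mpPow, mpId, h]
  | succ a ih =>
    intro i l j
    obtain ⟨k, -, hk⟩ := Finset.exists_mem_eq_sup (Finset.univ : Finset (Fin n)) ⟨i, Finset.mem_univ i⟩
      (fun k => M i k + mpPow M a k l)
    have hk' : mpPow M (a + 1) i l = M i k + mpPow M a k l := hk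
    rw [hk', add_assoc, show a + 1 + b = (a + b) + 1 by omega]
    refine le_trans (add_le_add le_rfl (ih k l j)) ?_
    exact Finset.le_sup (f := fun k => M i k + mpPow M (a + b) k j) (Finset.mem_univ k)

theorem mpx_pow_n {n : ℕ} (M : Fin n → Fin n → WithBot ℝ)
    (hM : ∀ i j, M i j ≤ (0 : WithBot ℝ)) (i j : Fin n) :
    mpPow M n i j ≤ (Finset.range n).sup fun t => mpPow M t i j := by
  rcases mpx_exists_walk M n i j with h | ⟨p, h0, hn, hp⟩
  · rw [h]; exact bot_le
  obtain ⟨a, b, hab, hbn, hpab⟩ : ∃ a b : ℕ, a < b ∧ b ≤ n ∧ p a = p b := by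
    obtain ⟨u, v, huv, e⟩ := Fintype.exists_ne_map_eq_of_card_lt
      (fun t : Fin (n + 1) => p t) (by simp)
    rcases lt_or_gt_of_ne huv with h | h
    · exact ⟨u, v, h, by omega, e⟩
    · exact ⟨v, u, h, by omega, e.symm⟩
  obtain ⟨c, rfl⟩ := Nat.exists_eq_add_of_lt hab
  obtain ⟨d, hd⟩ := Nat.exists_eq_add_of_le hbn
  have hsum : mpPow M n i j ≤ mpPow M (a + d) i j := by
    rw [hp]
    conv_lhs => rw [hd]
    rw [Finset.sum_range_add, show a + c + 1 = a + (c + 1) by omega, Finset.sum_range_add]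
    have h1 := mpx_walk_le M p a 0
    have h2 : ∑ t ∈ Finset.range (c + 1), M (p (a + t)) (p (a + t + 1)) ≤ 0 :=
      Finset.sum_nonpos fun t _ => hM _ _
    have h3 := mpx_walk_le M p d (a + (c + 1))
    simp only [zero_add] at h1
    have e1 : a + (c + 1) + d = n := by omega
    rw [e1, hn, show a + (c + 1) = a + c + 1 by omega, ← hpab] at h3
    rw [h0] at h1
    refine le_trans (add_le_add (add_le_add h1 h2) h3) ?_
    rw [add_zero]
    exact mpx_pow_add M a d i (p a) j
  exact hsum.trans (Finset.le_sup (f := fun t => mpPow M t i j) (Finset.mem_range.2 (by omega)))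

theorem mpx_pow_vec {n : ℕ} (M : Fin n → Fin n → WithBot ℝ) (x : Fin n → WithBot ℝ)
    (hx : mpMulVec M x ≤ x) (t : ℕ) : ∀ i j, mpPow M t i j + x j ≤ x i := by
  induction t with
  | zero =>
    intro i j
    by_cases h : i = j
    · simp [mpPow, mpId, h]
    · simp [mpPow, mpId, h]
  | succ t ih =>
    intro i j
    obtain ⟨k, -, hk⟩ := Finset.exists_mem_eq_sup (Finset.univ : Finset (Fin n)) ⟨i, Finset.mem_univ i⟩
      (fun k => M i k + mpPow M t k j)
    have hk' : mpPow M (t + 1) i j = M i k + mpPow M t k j := hk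
    rw [hk', add_assoc]
    refine le_trans (add_le_add le_rfl (ih k j)) (le_trans ?_ (hx i))
    exact Finset.le_sup (f := fun k => M i k + x k) (Finset.mem_univ k)

/-- For an `n × n` max-plus matrix `M` with all entries `≤ 0` and
`M* = I ⊕ M ⊕ ⋯ ⊕ M^{n−1}`: the set `{x : M ⊗ x ≤ x}` equals `{M* ⊗ y : y}`;
moreover `M ⊗ x ≤ x` iff `x = M* ⊗ x`. -/
theorem mp_star_cone_description {n : ℕ} (M : Fin n → Fin n → WithBot ℝ)
    (hM : ∀ i j, M i j ≤ (0 : WithBot ℝ))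
    (Mstar : Fin n → Fin n → WithBot ℝ)
    (hMstar : Mstar = fun i j => (Finset.range n).sup fun t => mpPow M t i j)
    (x : Fin n → WithBot ℝ) :
    (mpMulVec M x ≤ x ↔ ∃ y : Fin n → WithBot ℝ, x = mpMulVec Mstar y) ∧
      (mpMulVec M x ≤ x ↔ x = mpMulVec Mstar x) := by
  subst hMstar
  have A : mpMulVec M x ≤ x →
      x = mpMulVec (fun i j => (Finset.range n).sup fun t => mpPow M t i j) x := by
    intro hx
    funext i
    have hne : (Finset.range n).Nonempty := ⟨0, Finset.mem_range.2 (by have := i.2; omega)⟩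
    apply le_antisymm
    · have h1 : (0 : WithBot ℝ) ≤ (Finset.range n).sup fun t => mpPow M t i i :=
        le_trans (by simp [mpPow, mpId]) (Finset.le_sup (f := fun t => mpPow M t i i)
          (Finset.mem_range.2 (by have := i.2; omega) : 0 ∈ Finset.range n))
      refine le_trans ?_ (Finset.le_sup
        (f := fun k => ((Finset.range n).sup fun t => mpPow M t i k) + x k) (Finset.mem_univ i))
      simpa using add_le_add h1 (le_refl (x i))
    · refine Finset.sup_le fun j _ => ?_
      rw [add_comm]
      refine mpx_add_sup (n := n) hne _ _ _ fun t _ => ?_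
      rw [add_comm]
      exact mpx_pow_vec M x hx t i j
  have B : (∃ y : Fin n → WithBot ℝ,
      x = mpMulVec (fun i j => (Finset.range n).sup fun t => mpPow M t i j) y) →
      mpMulVec M x ≤ x := by
    rintro ⟨y, rfl⟩ i
    have hne : (Finset.range n).Nonempty := ⟨0, Finset.mem_range.2 (by have := i.2; omega)⟩
    refine Finset.sup_le fun k _ => ?_
    obtain ⟨j, -, hj⟩ := Finset.exists_mem_eq_sup (Finset.univ : Finset (Fin n))
      ⟨i, Finset.mem_univ i⟩
      (fun j => ((Finset.range n).sup fun t => mpPow M t k j) + y j)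
    have hj' : mpMulVec (fun i j => (Finset.range n).sup fun t => mpPow M t i j) y k =
      ((Finset.range n).sup fun t => mpPow M t k j) + y j := hj
    rw [hj', ← add_assoc]
    refine le_trans (add_le_add ?_ le_rfl) (Finset.le_sup
        (f := fun k => ((Finset.range n).sup fun t => mpPow M t i k) + y k) (Finset.mem_univ j))
    refine mpx_add_sup (n := n) hne _ _ _ fun t ht => ?_
    have h1 : M i k + mpPow M t k j ≤ mpPow M (t + 1) i j :=
      Finset.le_sup (f := fun k => M i k + mpPow M t k j) (Finset.mem_univ k)
    refine h1.trans ?_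
    have ht' := Finset.mem_range.1 ht
    rcases Nat.lt_or_ge (t + 1) n with h | h
    · exact Finset.le_sup (f := fun t => mpPow M t i j) (Finset.mem_range.2 h)
    · have e : t + 1 = n := by omega
      rw [e]
      exact mpx_pow_n M hM i j
  exact ⟨⟨fun h => ⟨x, A h⟩, B⟩, ⟨A, fun h => B ⟨x, h⟩⟩⟩

end
end

section
/- Let A be an n×n matrix over the max-plus semiring such that every circuit of its digraph G(A) has weight ≤ 0. Then A^n ≤ I_n ⊕ A ⊕ A^2 ⊕ ⋯ ⊕ A^{n−1} (entrywise). Consequently the Kleene star A* := I_n ⊕ A ⊕ ⋯ ⊕ A^{n−1} satisfies A ⊗ A* ⊕ I_n = A*. -/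
open Finset

noncomputable section

theorem mp_aux_step {n : ℕ} (A : Fin n → Fin n → WithBot ℝ) (k : ℕ) (i l j : Fin n) :
    A i l + mpPow A k l j ≤ mpPow A (k + 1) i j :=
  Finset.le_sup (f := fun l => A i l + mpPow A k l j) (Finset.mem_univ l)

theorem mp_aux_attain {n : ℕ} (A : Fin n → Fin n → WithBot ℝ) (k : ℕ) (i j : Fin n) :
    ∃ l, mpPow A (k + 1) i j = A i l + mpPow A k l j := by
  obtain ⟨l, -, h⟩ := Finset.exists_mem_eq_sup (Finset.univ : Finset (Fin n)) ⟨i, Finset.mem_univ i⟩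
    (fun l => A i l + mpPow A k l j)
  exact ⟨l, h⟩

theorem mp_aux_path_le {n : ℕ} (A : Fin n → Fin n → WithBot ℝ) (p : ℕ → Fin n) (k : ℕ) :
    (∑ t ∈ Finset.range k, A (p (t + 1)) (p t)) ≤ mpPow A k (p k) (p 0) := by
  induction k with
  | zero => simp [mpPow, mpId]
  | succ k ih =>
    rw [Finset.sum_range_succ, add_comm]
    exact (add_le_add le_rfl ih).trans (mp_aux_step A k _ _ _)

theorem mp_aux_exists_path {n : ℕ} (A : Fin n → Fin n → WithBot ℝ) (k : ℕ) :
    ∀ i j, mpPow A k i j ≠ ⊥ → ∃ p : ℕ → Fin n, p 0 = j ∧ p k = i ∧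
      mpPow A k i j = (∑ t ∈ Finset.range k, A (p (t + 1)) (p t)) ∧
      ∀ t < k, A (p (t + 1)) (p t) ≠ ⊥ := by
  induction k with
  | zero =>
    intro i j h
    have hij : i = j := by
      by_contra hne
      simp [mpPow, mpId, hne] at h
    subst hij
    exact ⟨fun _ => i, rfl, rfl, by simp [mpPow, mpId], by simp⟩
  | succ k ih =>
    intro i j h
    obtain ⟨l, hl⟩ := mp_aux_attain A k i j
    rw [hl] at h
    rw [WithBot.add_ne_bot] at h
    obtain ⟨p, h0, hk, hs, hb⟩ := ih l j h.2
    refine ⟨fun t => if t ≤ k then p t else i, by simp [h0], by simp, ?_, ?_⟩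
    · rw [hl, hs, Finset.sum_range_succ, add_comm]
      congr 1
      · apply Finset.sum_congr rfl
        intro t ht
        have := Finset.mem_range.1 ht
        have h1 : t + 1 ≤ k := this
        have h2 : t ≤ k := by omega
        simp [h1, h2]
      · simp [hk]
    · intro t ht
      rcases Nat.lt_succ_iff_lt_or_eq.1 ht with h1 | h1
      · have h2 : t + 1 ≤ k := h1
        have h3 : t ≤ k := by omega
        simpa [h2, h3] using hb t h1
      · subst h1
        simpa [hk] using h.1

theorem mp_aux_pow_add {n : ℕ} (A : Fin n → Fin n → WithBot ℝ) (a b : ℕ) :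
    ∀ i k j, mpPow A a i k + mpPow A b k j ≤ mpPow A (a + b) i j := by
  induction a with
  | zero =>
    intro i k j
    by_cases h : i = k
    · subst h; simp [mpPow, mpId]
    · simp [mpPow, mpId, h]
  | succ a ih =>
    intro i k j
    obtain ⟨l, hl⟩ := mp_aux_attain A a i k
    rw [hl, add_assoc, Nat.succ_add]
    exact (add_le_add le_rfl (ih l k j)).trans (mp_aux_step A _ _ _ _)

theorem mp_aux_main {n : ℕ} (A : Fin n → Fin n → WithBot ℝ)
    (hcirc : ∀ (m : ℕ) (p : ℕ → Fin n), p (m + 1) = p 0 →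
      (∀ t ≤ m, A (p (t + 1)) (p t) ≠ ⊥) →
      (∑ t ∈ Finset.range (m + 1), A (p (t + 1)) (p t)) ≤ (0 : WithBot ℝ)) (i j : Fin n) :
    mpPow A n i j ≤ (Finset.range n).sup fun t => mpPow A t i j := by
  by_cases hbot : mpPow A n i j = ⊥
  · rw [hbot]; exact bot_le
  obtain ⟨p, h0, hn, hs, hb⟩ := mp_aux_exists_path A n i j hbot
  have key : ∃ s m c : ℕ, s + (m + 1) + c = n ∧ p (s + (m + 1)) = p s := by
    obtain ⟨x, y, hxy, he⟩ := Fintype.exists_ne_map_eq_of_card_lt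
      (fun x : Fin (n + 1) => p x) (by simp)
    have hx := x.2
    have hy := y.2
    have hne : (x : ℕ) ≠ y := fun h => hxy (Fin.ext h)
    rcases lt_or_gt_of_ne hne with h | h
    · refine ⟨x, y - x - 1, n - y, by omega, ?_⟩
      rw [show (x : ℕ) + (y - x - 1 + 1) = y by omega]
      exact he.symm
    · refine ⟨y, x - y - 1, n - x, by omega, ?_⟩
      rw [show (y : ℕ) + (x - y - 1 + 1) = x by omega]
      exact he
  obtain ⟨s, m, c, hsum, hp⟩ := key
  have hmid := hcirc m (fun t => p (s + t)) (by simpa using hp)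
    (fun t ht => hb (s + t) (by omega))
  have h1 := mp_aux_path_le A p s
  have h2 := mp_aux_path_le A (fun t => p (s + (m + 1) + t)) c
  have hsplit : (∑ t ∈ Finset.range n, A (p (t + 1)) (p t)) ≤ mpPow A (c + s) i j := by
    rw [show Finset.range n = Finset.range (s + (m + 1) + c) from congrArg _ hsum.symm,
      Finset.sum_range_add, Finset.sum_range_add]
    simp only [add_zero, hp, hsum, hn, h0] at h1 h2
    calc _ ≤ mpPow A s (p s) j + 0 + mpPow A c i (p s) :=
          add_le_add (add_le_add h1 hmid) h2
      _ = mpPow A c i (p s) + mpPow A s (p s) j := by rw [add_zero, add_comm]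
      _ ≤ _ := mp_aux_pow_add A c s _ _ _
  rw [hs]
  exact hsplit.trans (Finset.le_sup (f := fun t => mpPow A t i j)
    (Finset.mem_range.2 (by omega)))

/-- If every circuit of `G(A)` has weight `≤ 0`, then `A^n ≤ I ⊕ A ⊕ ⋯ ⊕ A^{n−1}`
entrywise; consequently the Kleene star `A* = I ⊕ A ⊕ ⋯ ⊕ A^{n−1}` satisfies
`A ⊗ A* ⊕ I = A*`. -/
theorem mp_kleene_star {n : ℕ} (A : Fin n → Fin n → WithBot ℝ)
    (hcirc : ∀ (m : ℕ) (p : ℕ → Fin n), p (m + 1) = p 0 →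
      (∀ t ≤ m, A (p (t + 1)) (p t) ≠ ⊥) →
      (∑ t ∈ Finset.range (m + 1), A (p (t + 1)) (p t)) ≤ (0 : WithBot ℝ))
    (Astar : Fin n → Fin n → WithBot ℝ)
    (hAstar : Astar = fun i j => (Finset.range n).sup fun t => mpPow A t i j) :
    mpPow A n ≤ Astar ∧ (fun i j => mpMul A Astar i j ⊔ mpId n i j) = Astar := by
  subst hAstar
  refine ⟨fun i j => mp_aux_main A hcirc i j, ?_⟩
  funext i j
  have hpos : 0 < n := i.pos
  apply le_antisymm
  · apply sup_le
    · apply Finset.sup_le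
      intro k _
      obtain ⟨t, ht, h⟩ := Finset.exists_mem_eq_sup (Finset.range n) ⟨0, Finset.mem_range.2 hpos⟩
        (fun t => mpPow A t k j)
      have ht' := Finset.mem_range.1 ht
      simp only [h]
      refine (mp_aux_step A t i k j).trans ?_
      rcases Nat.lt_or_ge (t + 1) n with h1 | h1
      · exact Finset.le_sup (f := fun t => mpPow A t i j) (Finset.mem_range.2 h1)
      · have h2 : t + 1 = n := by omega
        rw [h2]
        exact mp_aux_main A hcirc i j
    · exact Finset.le_sup (f := fun t => mpPow A t i j) (Finset.mem_range.2 hpos)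
  · apply Finset.sup_le
    intro t ht
    have ht' := Finset.mem_range.1 ht
    cases t with
    | zero => exact le_sup_right
    | succ t =>
      refine le_trans ?_ le_sup_left
      obtain ⟨k, h⟩ := mp_aux_attain A t i j
      have hk := Finset.mem_univ k
      rw [h]
      refine le_trans ?_ (Finset.le_sup (f := fun k => A i k + (Finset.range n).sup fun t => mpPow A t k j) hk)
      exact add_le_add le_rfl (Finset.le_sup (f := fun t => mpPow A t k j)
        (Finset.mem_range.2 (by omega)))

end
end
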